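/- arXiv:2107.03715 — 7 statements merged into one kernel-verified Lean document; each statement's English description precedes it below -/
import Mathlib

section
/- For all positive integers g and m, the function r(t) = (1−g)t satisfies, for every real t, the equation 0 = 4 sin²(gt)·r''(t) + 2gm sin(2gt)·r'(t) − 2g(g−2) m sin(2(r(t)−t)) − 4gm sin(2(r(t)−t) + gt)·cos(gt). (That is, in the case of equal multiplicities m0 = m1 = m, the linear function r(t) = (1−g)t solves the equation characterizing equivariant harmonic self-maps of the sphere.) -/
open Real

/-- In the case of equal multiplicities `m0 = m1 = m`, the linear function `r(t) = (1-g)t`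
solves the equation characterizing equivariant harmonic self-maps of the sphere. -/
theorem linear_solution_sphere_ode (g m : ℕ) (hg : 0 < g) (hm : 0 < m)
    (r : ℝ → ℝ) (hr : r = fun t : ℝ => (1 - (g : ℝ)) * t) :
    ∀ t : ℝ, (0 : ℝ) =
      4 * sin (g * t) ^ 2 * deriv (deriv r) t
      + 2 * (g : ℝ) * (m : ℝ) * sin (2 * g * t) * deriv r t
      - 2 * (g : ℝ) * ((g : ℝ) - 2) * (m : ℝ) * sin (2 * (r t - t))
      - 4 * (g : ℝ) * (m : ℝ) * sin (2 * (r t - t) + g * t) * cos (g * t) := by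
  intro t
  have hd : deriv r = fun _ => 1 - (g : ℝ) := by
    funext x
    simp [hr]
  have h₁ : 2 * (r t - t) = -(2 * (g * t)) := by rw [hr]; ring
  have h₂ : -(2 * (g * t)) + g * t = -(g * t) := by ring
  rw [hd, deriv_const, h₁, h₂, mul_assoc 2 (g : ℝ) t, sin_neg, sin_neg, sin_two_mul]
  ring
end

section
/- Let g, m0, m1 be positive integers and λ ∈ ℝ. Let ξ : (0, π/g) → ℝ be twice continuously differentiable and suppose that for all t ∈ (0, π/g): ξ''(t) + (m0−m1 + (m0+m1) cos(gt))·(g/(2 sin(gt)))·ξ'(t) − (g/(2 sin²(gt)))·[(g−2)(m0+m1 + (m0−m1) cos(gt)) + 2 cos(gt)(m0−m1 + (m0+m1) cos(gt))]·ξ(t) + λ ξ(t) = 0. Define η : ℝ → ℝ by η(x) = ξ((2/g)·arctan(e^x)). Then for all x ∈ ℝ: η''(x) + (1/2)(m0−m1 + (2−(m0+m1)) tanh x)·η'(x) − (1/2)(m0+m1 − (m0−m1) tanh x)·η(x) + (λ/g² + (m0+m1)/g)·η(x)/cosh²x = 0. -/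
open Real

theorem sin_two_mul_arctan_exp (x : ℝ) : sin (2 * arctan (exp x)) = 1 / cosh x := by
  have hE := exp_pos x
  have h := sq_sqrt (show (0 : ℝ) ≤ 1 + exp x ^ 2 by positivity)
  rw [sin_two_mul, sin_arctan, cos_arctan, cosh_eq, exp_neg]
  field_simp
  rw [h]
  ring

theorem cos_two_mul_arctan_exp (x : ℝ) : cos (2 * arctan (exp x)) = -tanh x := by
  have hE := exp_pos x
  rw [cos_two_mul, cos_sq_arctan, tanh_eq_sinh_div_cosh, sinh_eq, cosh_eq, exp_neg]
  field_simp
  ring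

theorem hasDerivAt_arctan_exp (x : ℝ) :
    HasDerivAt (fun y : ℝ => arctan (exp y)) (1 / (2 * cosh x)) x := by
  have hE := exp_pos x
  convert (hasDerivAt_exp x).arctan using 1
  rw [cosh_eq, exp_neg]
  field_simp
  ring

theorem two_div_mul_arctan_exp_mem_Ioo {c : ℝ} (hc : 0 < c) (x : ℝ) :
    2 / c * arctan (exp x) ∈ Set.Ioo 0 (π / c) := by
  refine ⟨mul_pos (by positivity) (arctan_pos.2 (exp_pos x)), ?_⟩
  rw [div_mul_eq_mul_div]
  gcongr
  linarith [arctan_lt_pi_div_two (exp x)]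

/-- The change of variables `t = (2/g) arctan (e^x)` transforms the Jacobi equation along
the identity solution `r(t) = t` on `(0, π/g)` into the stated equation on `ℝ`, with the
spectral parameter rescaled by `g²`. -/
theorem jacobi_change_of_variables_sphere_identity (g m0 m1 : ℕ) (hg : 0 < g)
    (hm0 : 0 < m0) (hm1 : 0 < m1) (lam : ℝ) (ξ : ℝ → ℝ)
    (hsmooth : ContDiffOn ℝ 2 ξ (Set.Ioo 0 (π / g)))
    (heq : ∀ t ∈ Set.Ioo (0 : ℝ) (π / g),
      deriv (deriv ξ) t
      + ((m0 : ℝ) - m1 + ((m0 : ℝ) + m1) * cos (g * t)) * ((g : ℝ) / (2 * sin (g * t)))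
          * deriv ξ t
      - ((g : ℝ) / (2 * sin (g * t) ^ 2))
          * (((g : ℝ) - 2) * ((m0 : ℝ) + m1 + ((m0 : ℝ) - m1) * cos (g * t))
            + 2 * cos (g * t) * ((m0 : ℝ) - m1 + ((m0 : ℝ) + m1) * cos (g * t))) * ξ t
      + lam * ξ t = 0)
    (η : ℝ → ℝ) (hη : η = fun x : ℝ => ξ ((2 / (g : ℝ)) * arctan (exp x))) :
    ∀ x : ℝ,
      deriv (deriv η) x
      + (1 / 2) * ((m0 : ℝ) - m1 + (2 - ((m0 : ℝ) + m1)) * tanh x) * deriv η x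
      - (1 / 2) * ((m0 : ℝ) + m1 - ((m0 : ℝ) - m1) * tanh x) * η x
      + (lam / (g : ℝ) ^ 2 + ((m0 : ℝ) + m1) / g) * η x / cosh x ^ 2 = 0 := by
  intro x
  have hG : (0 : ℝ) < g := by exact_mod_cast hg
  generalize (g : ℝ) = c at *
  have hmem := two_div_mul_arctan_exp_mem_Ioo hG
  have hτ (y : ℝ) : HasDerivAt (fun z : ℝ => 2 / c * arctan (exp z)) (1 / (c * cosh y)) y := by
    refine ((hasDerivAt_arctan_exp y).const_mul (2 / c)).congr_deriv ?_
    have := cosh_pos y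
    field_simp
  have hξ (t : ℝ) (ht : t ∈ Set.Ioo 0 (π / c)) : HasDerivAt ξ (deriv ξ t) t :=
    ((hsmooth.contDiffAt (isOpen_Ioo.mem_nhds ht)).differentiableAt (by norm_num)).hasDerivAt
  have hξ' (t : ℝ) (ht : t ∈ Set.Ioo 0 (π / c)) :
      HasDerivAt (deriv ξ) (deriv (deriv ξ) t) t :=
    (((hsmooth.deriv_of_isOpen isOpen_Ioo (m := 1) (by norm_num)).contDiffAt
      (isOpen_Ioo.mem_nhds ht)).differentiableAt (by norm_num)).hasDerivAt
  have hη' : deriv η = fun y => deriv ξ (2 / c * arctan (exp y)) * (1 / (c * cosh y)) := by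
    funext y
    rw [hη]
    exact ((hξ _ (hmem y)).comp y (hτ y)).deriv
  have hC := cosh_pos x
  have hw : HasDerivAt (fun y : ℝ => 1 / (c * cosh y)) (-sinh x / (c * cosh x ^ 2)) x := by
    simp only [one_div]
    refine (((hasDerivAt_cosh x).const_mul c).fun_inv (by positivity)).congr_deriv ?_
    field_simp
  have hη'' := (((hξ' _ (hmem x)).comp x (hτ x)).mul hw).deriv
  have key := heq _ (hmem x)
  have harg : c * (2 / c * arctan (exp x)) = 2 * arctan (exp x) := by field_simp
  rw [harg, sin_two_mul_arctan_exp, cos_two_mul_arctan_exp] at key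
  rw [hη']
  change deriv (deriv ξ ∘ (fun z : ℝ => 2 / c * arctan (exp z)) * fun y => 1 / (c * cosh y)) x
    + _ - _ + _ = 0
  rw [hη'', hη]
  simp only [Function.comp_apply]
  rw [tanh_eq_sinh_div_cosh] at *
  generalize ξ (2 / c * arctan (exp x)) = a at *
  generalize deriv ξ (2 / c * arctan (exp x)) = b at *
  generalize deriv (deriv ξ) (2 / c * arctan (exp x)) = d at *
  have hS := sinh_sq x
  generalize sinh x = s at *
  generalize cosh x = C at *
  field_simp at key ⊢
  linear_combination key + 2 * c * ((m0 : ℝ) + m1) * a * hS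
end

section
/- For all positive integers g, m0, m1, the function ξ(x) = 1/cosh x satisfies, for all x ∈ ℝ, the equation ξ''(x) + (1/2)(m0−m1 + (2−(m0+m1)) tanh x)·ξ'(x) − (1/2)(m0+m1 − (m0−m1) tanh x)·ξ(x) + (λ + (m0+m1)/g)·ξ(x)/cosh²x = 0 with λ = 1 + (m0+m1)/2 − (m0+m1)/g. -/
open Real

theorem hasDerivAt_one_div_cosh (x : ℝ) :
    HasDerivAt (fun x : ℝ => 1 / cosh x) (-sinh x / cosh x ^ 2) x := by
  simpa only [one_div] using (hasDerivAt_cosh x).fun_inv (cosh_pos x).ne'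

theorem hasDerivAt_neg_sinh_div_cosh_sq (x : ℝ) :
    HasDerivAt (fun x : ℝ => -sinh x / cosh x ^ 2)
      (-1 / cosh x + 2 * sinh x ^ 2 / cosh x ^ 3) x := by
  have hc := (cosh_pos x).ne'
  refine ((hasDerivAt_sinh x).fun_neg.fun_div ((hasDerivAt_cosh x).fun_pow 2)
    (pow_ne_zero 2 hc)).congr_deriv ?_
  field_simp
  ring

/-- The function `ξ(x) = 1/cosh x` is an eigenfunction of the Jacobi operator of the identity
self-map of the sphere with eigenvalue `λ = 1 + (m0+m1)/2 - (m0+m1)/g`. -/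
theorem first_eigenfunction_sphere_identity (g m0 m1 : ℕ) (hg : 0 < g) (hm0 : 0 < m0)
    (hm1 : 0 < m1) (lam : ℝ)
    (hlam : lam = 1 + ((m0 : ℝ) + m1) / 2 - ((m0 : ℝ) + m1) / g)
    (ξ : ℝ → ℝ) (hξ : ξ = fun x : ℝ => 1 / cosh x) :
    ∀ x : ℝ,
      deriv (deriv ξ) x
      + (1 / 2) * ((m0 : ℝ) - m1 + (2 - ((m0 : ℝ) + m1)) * tanh x) * deriv ξ x
      - (1 / 2) * ((m0 : ℝ) + m1 - ((m0 : ℝ) - m1) * tanh x) * ξ x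
      + (lam + ((m0 : ℝ) + m1) / g) * ξ x / cosh x ^ 2 = 0 := by
  intro x
  have hd : deriv ξ = fun x => -sinh x / cosh x ^ 2 := by
    rw [hξ]
    exact funext fun y => (hasDerivAt_one_div_cosh y).deriv
  rw [hd, (hasDerivAt_neg_sinh_div_cosh_sq x).deriv, hξ, tanh_eq_sinh_div_cosh,
    show lam + ((m0 : ℝ) + m1) / g = 1 + ((m0 : ℝ) + m1) / 2 by rw [hlam]; ring]
  have hc := (cosh_pos x).ne'
  have hs := sinh_sq x
  field_simp
  linear_combination (2 + (m0 : ℝ) + m1) * hs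
end

section
/- For all positive integers g, m0, m1 and every integer j ≥ 1, there exists a nonzero real polynomial u of degree j−1 such that the function ξ(x) = u(tanh x)/cosh x satisfies, for all x ∈ ℝ, the equation ξ''(x) + (1/2)(m0−m1 + (2−(m0+m1)) tanh x)·ξ'(x) − (1/2)(m0+m1 − (m0−m1) tanh x)·ξ(x) + (λ_j + (m0+m1)/g)·ξ(x)/cosh²x = 0, where λ_j = −(m0+m1)/g + j(j + (m0+m1)/2). (The polynomial u may be taken to be the Jacobi polynomial P_{j−1}^{((m1+1)/2, (m0+1)/2)}.) -/
open Real

open Polynomial in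
/-- The partial sums of the hypergeometric series in powers of `X + 1` solve the Jacobi equation
up to a multiple of the last power. -/
lemma exists_partial_solution_jacobi (p q N : ℝ) (n : ℕ) (hr : 0 < p + q)
    (hN : ∀ k < n, N ≠ k * (k + q - 1)) (m : ℕ) (hm : m ≤ n) :
    ∃ (u : ℝ[X]) (c : ℝ), c ≠ 0 ∧ u ≠ 0 ∧ u.natDegree = m ∧
      (1 - X ^ 2) * derivative (derivative u) + (C p - C q * X) * derivative u + C N * u
        = C ((N - m * (m + q - 1)) * c) * (X + C 1) ^ m := by
  induction m with
  | zero => exact ⟨1, 1, one_ne_zero, one_ne_zero, natDegree_one, by simp⟩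
  | succ m ih =>
    obtain ⟨u, c, hc, hu, hdeg, h⟩ := ih (by omega)
    have hpos : 0 < ((m : ℝ) + 1) * (2 * m + (p + q)) := by positivity
    set d : ℝ := -((N - m * (m + q - 1)) * c) / ((m + 1) * (2 * m + (p + q))) with hd
    have hd0 : d ≠ 0 :=
      div_ne_zero (neg_ne_zero.2 (mul_ne_zero (sub_ne_zero.2 (hN m (by omega))) hc)) hpos.ne'
    have hdc : (N - m * (m + q - 1)) * c = -(d * ((m + 1) * (2 * m + (p + q)))) := by
      rw [hd, div_mul_cancel₀ _ hpos.ne', neg_neg]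
    have hdeg' : (C d * (X + C 1) ^ (m + 1) : ℝ[X]).natDegree = m + 1 := by
      rw [natDegree_C_mul hd0, natDegree_pow, natDegree_X_add_C, mul_one]
    have hsum : (u + C d * (X + C 1) ^ (m + 1)).natDegree = m + 1 := by
      rw [natDegree_add_eq_right_of_natDegree_lt (by omega), hdeg']
    refine ⟨_, d, hd0, fun h0 => ?_, hsum, ?_⟩
    · rw [h0, natDegree_zero] at hsum
      omega
    · have h1 : derivative ((X + C 1 : ℝ[X]) ^ (m + 1)) = C ((m : ℝ) + 1) * (X + C 1) ^ m := by
        rw [derivative_X_add_C_pow]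
        simp
      have h2 : (X + C 1 : ℝ[X]) * derivative ((X + C 1 : ℝ[X]) ^ m)
          = C (m : ℝ) * (X + C 1) ^ m := by
        rw [derivative_X_add_C_pow]
        cases m with
        | zero => simp
        | succ k =>
          simp only [Nat.add_sub_cancel, map_natCast]
          ring
      rw [hdc] at h
      simp only [derivative_add, derivative_C_mul, h1]
      simp only [map_add, map_sub, map_mul, map_neg, map_one, map_ofNat, Nat.cast_add,
        Nat.cast_one] at h h2 ⊢
      linear_combination h + C d * (C (m : ℝ) + 1) * (1 - X) * h2

open Polynomial in
/-- For `q > 1` and `p + q > 0` the Jacobi equation has a polynomial solution of every degree. -/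
lemma exists_polynomial_solution_jacobi (p q : ℝ) (hr : 0 < p + q) (hq : 1 < q) (n : ℕ) :
    ∃ u : ℝ[X], u ≠ 0 ∧ u.natDegree = n ∧ ∀ s : ℝ,
      (1 - s ^ 2) * (derivative (derivative u)).eval s + (p - q * s) * (derivative u).eval s
        + n * (n + q - 1) * u.eval s = 0 := by
  obtain ⟨u, c, -, hu, hdeg, h⟩ := exists_partial_solution_jacobi p q (n * (n + q - 1)) n hr
    (fun k hk => by
      have hkn : (k : ℝ) < n := by exact_mod_cast hk
      have : (0 : ℝ) ≤ k := k.cast_nonneg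
      nlinarith [mul_pos (sub_pos.2 hkn) (show 0 < (n : ℝ) + k + (q - 1) by linarith)]) n le_rfl
  refine ⟨u, hu, hdeg, fun s => ?_⟩
  simpa using congrArg (eval s) h

lemma Real.hasDerivAt_tanh_one_sub_sq (x : ℝ) : HasDerivAt tanh (1 - tanh x ^ 2) x := by
  have h := (hasDerivAt_sinh x).div (hasDerivAt_cosh x) (cosh_pos x).ne'
  rw [show tanh = sinh / cosh from funext tanh_eq_sinh_div_cosh]
  refine h.congr_deriv ?_
  have := (cosh_pos x).ne'
  rw [Pi.div_apply]
  field_simp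

open Polynomial in
lemma hasDerivAt_eval_tanh_div_cosh (u : ℝ[X]) (x : ℝ) :
    HasDerivAt (fun y : ℝ => u.eval (tanh y) / cosh y)
      (((1 - X ^ 2) * derivative u - X * u).eval (tanh x) / cosh x) x := by
  have h := ((u.hasDerivAt (tanh x)).comp x (hasDerivAt_tanh_one_sub_sq x)).div
    (hasDerivAt_cosh x) (cosh_pos x).ne'
  refine h.congr_deriv ?_
  have := (cosh_pos x).ne'
  have hs : sinh x = tanh x * cosh x := by rw [tanh_eq_sinh_div_cosh, div_mul_cancel₀ _ this]
  simp only [Function.comp_apply, hs, eval_sub, eval_mul, eval_one, eval_pow, eval_X]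
  field_simp

/-- For every `j ≥ 1` there is a nonzero polynomial `u` of degree `j - 1` such that
`ξ(x) = u(tanh x)/cosh x` is an eigenfunction of the Jacobi operator of the identity
self-map of the sphere with eigenvalue `λ_j = -(m0+m1)/g + j(j+(m0+m1)/2)`. -/
theorem spectrum_sphere_identity (g m0 m1 : ℕ) (hg : 0 < g) (hm0 : 0 < m0) (hm1 : 0 < m1)
    (j : ℕ) (hj : 1 ≤ j) :
    ∃ u : Polynomial ℝ, u ≠ 0 ∧ u.natDegree = j - 1 ∧
      ∀ x : ℝ,
        deriv (deriv (fun y : ℝ => u.eval (tanh y) / cosh y)) x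
        + (1 / 2) * ((m0 : ℝ) - m1 + (2 - ((m0 : ℝ) + m1)) * tanh x)
            * deriv (fun y : ℝ => u.eval (tanh y) / cosh y) x
        - (1 / 2) * ((m0 : ℝ) + m1 - ((m0 : ℝ) - m1) * tanh x)
            * (u.eval (tanh x) / cosh x)
        + ((-(((m0 : ℝ) + m1) / g) + j * (j + ((m0 : ℝ) + m1) / 2)) + ((m0 : ℝ) + m1) / g)
            * (u.eval (tanh x) / cosh x) / cosh x ^ 2 = 0 := by
  obtain ⟨n, rfl⟩ := Nat.exists_eq_add_of_le' hj
  have h0 : (0 : ℝ) ≤ m0 := m0.cast_nonneg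
  have h1 : (0 : ℝ) ≤ m1 := m1.cast_nonneg
  obtain ⟨u, hu, hdeg, h⟩ := exists_polynomial_solution_jacobi (((m0 : ℝ) - m1) / 2)
    (3 + ((m0 : ℝ) + m1) / 2) (by linarith) (by linarith) n
  refine ⟨u, hu, by simpa using hdeg, fun x => ?_⟩
  have hderiv (v : Polynomial ℝ) := funext fun x => (hasDerivAt_eval_tanh_div_cosh v x).deriv
  have hc := (cosh_pos x).ne'
  have hsech : (1 : ℝ) / cosh x ^ 2 = 1 - tanh x ^ 2 := by
    rw [tanh_eq_sinh_div_cosh]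
    field_simp
    linarith [cosh_sq x]
  rw [hderiv, hderiv, div_eq_mul_one_div _ (cosh x ^ 2), hsech]
  simp only [Polynomial.derivative_sub, Polynomial.derivative_mul, Polynomial.derivative_one,
    Polynomial.derivative_X_pow, Polynomial.derivative_X, Polynomial.eval_sub,
    Polynomial.eval_add, Polynomial.eval_mul, Polynomial.eval_one, Polynomial.eval_pow,
    Polynomial.eval_X, Polynomial.eval_zero, Polynomial.eval_C]
  push_cast
  linear_combination (1 - tanh x ^ 2) / cosh x * h (tanh x)
end

section
/- For all positive integers g and m, the function r(t) = (1−2g)t satisfies, for every real t, the equation 0 = 4 sin²(2gt)·r''(t) + 4gm sin(4gt)·r'(t) − 8g(g−1)m sin(2(r(t)−t)) − 8gm sin(2(r(t)−t) + 2gt)·cos(2gt). (That is, in the case m0 = m1 = m, the linear function r(t) = (1−2g)t solves the equation characterizing equivariant harmonic self-maps of SO(2gm+2).) -/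
open Real

/-- In the case `m0 = m1 = m`, the linear function `r(t) = (1-2g)t` solves the equation
characterizing equivariant harmonic self-maps of `SO(2gm+2)`. -/
theorem linear_solution_so_ode (g m : ℕ) (hg : 0 < g) (hm : 0 < m)
    (r : ℝ → ℝ) (hr : r = fun t : ℝ => (1 - 2 * (g : ℝ)) * t) :
    ∀ t : ℝ, (0 : ℝ) =
      4 * sin (2 * g * t) ^ 2 * deriv (deriv r) t
      + 4 * (g : ℝ) * (m : ℝ) * sin (4 * g * t) * deriv r t
      - 8 * (g : ℝ) * ((g : ℝ) - 1) * (m : ℝ) * sin (2 * (r t - t))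
      - 8 * (g : ℝ) * (m : ℝ) * sin (2 * (r t - t) + 2 * g * t) * cos (2 * g * t) := by
  intro t
  have hd : deriv r = fun _ => 1 - 2 * (g : ℝ) := by
    subst hr
    funext x
    simp
  have hsub : 2 * (r t - t) = -(2 * (2 * g * t)) := by
    rw [hr]
    ring
  have hadd : -(2 * (2 * g * t)) + 2 * g * t = -(2 * g * t) := by ring
  have hdouble : 4 * g * t = 2 * (2 * g * t) := by ring
  rw [hd, hsub, hadd, hdouble, deriv_const, sin_neg, sin_neg, sin_two_mul]
  ring
end

section
/- For all positive integers g, m0, m1 and every integer j ≥ 1, there exists a nonzero real polynomial u of degree j−1 such that the function ξ(x) = u(tanh x)/cosh x satisfies, for all x ∈ ℝ, the equation ξ''(x) + (1/2)(m0−m1 + (2−(m0+m1)) tanh x)·ξ'(x) − (1/2)(m0+m1 − (m0−m1) tanh x)·ξ(x) + (λ_j + (m0+m1)/(2g))·ξ(x)/cosh²x = 0, where λ_j = −(m0+m1)/(2g) + j(j + (m0+m1)/2). (The polynomial u may be taken to be the Jacobi polynomial P_{j−1}^{((m1+1)/2, (m0+1)/2)}.) -/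
open Real

/-- For `n ≤ k` there is a polynomial of degree `n` (a partial sum of the power series solution
at `t = 1`) that satisfies the Jacobi equation up to a multiple of `(t - 1) ^ n`, which vanishes
when `n = k`. -/
theorem exists_polynomial_jacobi_remainder (A B : ℝ) (hB : 0 < B) (hAB : A - B < 0) (k n : ℕ)
    (hn : n ≤ k) :
    ∃ (p : Polynomial ℝ) (c : ℝ), c ≠ 0 ∧ p ≠ 0 ∧ p.natDegree = n ∧ ∀ t : ℝ,
      (1 - t ^ 2) * p.derivative.derivative.eval t + (A - B * t) * p.derivative.eval t
        + k * (k - 1 + B) * p.eval t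
        = c * (k * (k - 1 + B) - n * (n - 1 + B)) * (t - 1) ^ n := by
  induction n with
  | zero => exact ⟨1, 1, one_ne_zero, one_ne_zero, by simp, fun t => by simp⟩
  | succ n ih =>
    obtain ⟨p, c, hc, hp, hdeg, h⟩ := ih (by omega)
    have hlt : (n : ℝ) + 1 ≤ k := by exact_mod_cast hn
    have hn0 : (0 : ℝ) ≤ n := n.cast_nonneg
    have hμ : (k * (k - 1 + B) - n * (n - 1 + B) : ℝ) ≠ 0 := by
      have : (k * (k - 1 + B) - n * (n - 1 + B) : ℝ) = (k - n) * (k + n - 1 + B) := by ring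
      rw [this]
      exact mul_ne_zero (by linarith) (by linarith)
    have hd : ((n + 1) * (A - B - 2 * n) : ℝ) ≠ 0 := mul_ne_zero (by linarith) (by linarith)
    obtain ⟨d, hd0, hdc⟩ : ∃ d : ℝ, d ≠ 0 ∧
        d * ((n + 1) * (A - B - 2 * n)) = -(c * (k * (k - 1 + B) - n * (n - 1 + B))) :=
      ⟨-(c * (k * (k - 1 + B) - n * (n - 1 + B))) / ((n + 1) * (A - B - 2 * n)),
        div_ne_zero (neg_ne_zero.2 (mul_ne_zero hc hμ)) hd, div_mul_cancel₀ _ hd⟩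
    have hq : (Polynomial.C d * (Polynomial.X - Polynomial.C 1) ^ (n + 1)).natDegree = n + 1 := by
      rw [Polynomial.natDegree_C_mul hd0, Polynomial.natDegree_pow, Polynomial.natDegree_X_sub_C,
        mul_one]
    have hsum : (p + Polynomial.C d * (Polynomial.X - Polynomial.C 1) ^ (n + 1)).natDegree
        = n + 1 := by
      rw [Polynomial.natDegree_add_eq_right_of_natDegree_lt (by omega), hq]
    refine ⟨p + Polynomial.C d * (Polynomial.X - Polynomial.C 1) ^ (n + 1), d, hd0, ?_, hsum, ?_⟩
    · intro h0
      rw [h0, Polynomial.natDegree_zero] at hsum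
      omega
    · intro t
      have ht := h t
      rcases n with _ | m
      · simp at ht hdc ⊢
        linear_combination ht + hdc
      · simp [Polynomial.derivative_pow] at ht hdc ⊢
        linear_combination ht + (t - 1) ^ (m + 1) * hdc

/-- The Jacobi equation `(1 - t²) u'' + (A - B t) u' + k (k - 1 + B) u = 0` has a polynomial
solution of degree `k`. -/
theorem exists_polynomial_jacobi (A B : ℝ) (hB : 0 < B) (hAB : A - B < 0) (k : ℕ) :
    ∃ p : Polynomial ℝ, p ≠ 0 ∧ p.natDegree = k ∧ ∀ t : ℝ,
      (1 - t ^ 2) * p.derivative.derivative.eval t + (A - B * t) * p.derivative.eval t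
        + k * (k - 1 + B) * p.eval t = 0 := by
  obtain ⟨p, c, -, hp, hdeg, h⟩ := exists_polynomial_jacobi_remainder A B hB hAB k k le_rfl
  exact ⟨p, hp, hdeg, fun t => by rw [h t]; ring⟩

theorem hasDerivAt_tanh_sech_sq (x : ℝ) : HasDerivAt tanh ((1 / cosh x) ^ 2) x := by
  have hc := (cosh_pos x).ne'
  have h := (hasDerivAt_sinh x).div (hasDerivAt_cosh x) hc
  have he : tanh = fun y => sinh y / cosh y := funext tanh_eq_sinh_div_cosh
  rw [he]
  refine h.congr_deriv ?_
  field_simp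
  linear_combination cosh_sq x

theorem hasDerivAt_sech (x : ℝ) :
    HasDerivAt (fun y => 1 / cosh y) (-(tanh x * (1 / cosh x))) x := by
  have hc := (cosh_pos x).ne'
  refine ((hasDerivAt_const x (1 : ℝ)).div (hasDerivAt_cosh x) hc).congr_deriv ?_
  rw [tanh_eq_sinh_div_cosh]
  field_simp
  ring

theorem sech_sq (x : ℝ) : (1 / cosh x) ^ 2 = 1 - tanh x ^ 2 := by
  have hc := (cosh_pos x).ne'
  rw [tanh_eq_sinh_div_cosh]
  field_simp
  linear_combination -cosh_sq x

theorem hasDerivAt_eval_tanh_mul_sech (p : Polynomial ℝ) (x : ℝ) :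
    HasDerivAt (fun y => p.eval (tanh y) * (1 / cosh y))
      (((1 - Polynomial.X ^ 2) * p.derivative - Polynomial.X * p).eval (tanh x)
        * (1 / cosh x)) x := by
  refine (((p.hasDerivAt (tanh x)).comp x (hasDerivAt_tanh_sech_sq x)).mul
    (hasDerivAt_sech x)).congr_deriv ?_
  simp only [Polynomial.eval_sub, Polynomial.eval_mul, Polynomial.eval_one, Polynomial.eval_pow,
    Polynomial.eval_X, sech_sq, Function.comp_apply]
  ring

/-- For every `j ≥ 1` there is a nonzero polynomial `u` of degree `j - 1` such that
`ξ(x) = u(tanh x)/cosh x` is an eigenfunction of the Jacobi operator of the identity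
self-map of `SO(n+2)`, `n = g(m0+m1)`, with eigenvalue
`λ_j = -(m0+m1)/(2g) + j(j+(m0+m1)/2)`. -/
theorem spectrum_so_identity (g m0 m1 : ℕ) (hg : 0 < g) (hm0 : 0 < m0) (hm1 : 0 < m1)
    (j : ℕ) (hj : 1 ≤ j) :
    ∃ u : Polynomial ℝ, u ≠ 0 ∧ u.natDegree = j - 1 ∧
      ∀ x : ℝ,
        deriv (deriv (fun y : ℝ => u.eval (tanh y) / cosh y)) x
        + (1 / 2) * ((m0 : ℝ) - m1 + (2 - ((m0 : ℝ) + m1)) * tanh x)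
            * deriv (fun y : ℝ => u.eval (tanh y) / cosh y) x
        - (1 / 2) * ((m0 : ℝ) + m1 - ((m0 : ℝ) - m1) * tanh x)
            * (u.eval (tanh x) / cosh x)
        + ((-(((m0 : ℝ) + m1) / (2 * g)) + j * (j + ((m0 : ℝ) + m1) / 2))
              + ((m0 : ℝ) + m1) / (2 * g))
            * (u.eval (tanh x) / cosh x) / cosh x ^ 2 = 0 := by
  obtain ⟨u, hu, hdeg, h⟩ := exists_polynomial_jacobi (((m0 : ℝ) - m1) / 2)
    (3 + ((m0 : ℝ) + m1) / 2) (by positivity)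
    (by linarith [(m1.cast_nonneg : (0 : ℝ) ≤ m1)]) (j - 1)
  refine ⟨u, hu, hdeg, fun x => ?_⟩
  have hd (p : Polynomial ℝ) : deriv (fun y => p.eval (tanh y) * (1 / cosh y)) = fun y =>
      ((1 - Polynomial.X ^ 2) * p.derivative - Polynomial.X * p).eval (tanh y) * (1 / cosh y) :=
    funext fun y => (hasDerivAt_eval_tanh_mul_sech p y).deriv
  have hf : (fun y : ℝ => u.eval (tanh y) / cosh y) = fun y => u.eval (tanh y) * (1 / cosh y) :=
    funext fun y => div_eq_mul_one_div _ _
  have hlast (a : ℝ) : a * (u.eval (tanh x) / cosh x) / cosh x ^ 2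
      = a * u.eval (tanh x) * (1 / cosh x) * (1 - tanh x ^ 2) := by
    rw [← sech_sq]
    ring
  have hx := h (tanh x)
  rw [Nat.cast_sub hj] at hx
  rw [hlast, hf, hd, hd, div_eq_mul_one_div (u.eval (tanh x))]
  simp only [Polynomial.derivative_sub, Polynomial.derivative_mul, Polynomial.derivative_one,
    Polynomial.derivative_X_pow, Polynomial.derivative_X, Polynomial.eval_sub, Polynomial.eval_add,
    Polynomial.eval_mul, Polynomial.eval_one, Polynomial.eval_pow, Polynomial.eval_X,
    Polynomial.eval_C, Polynomial.eval_zero]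
  push_cast at hx ⊢
  linear_combination (1 / cosh x) * (1 - tanh x ^ 2) * hx
end

section
/- The function ξ(x) = cosh²x satisfies, for all x ∈ ℝ, the equation ξ''(x) − tanh x·ξ'(x) − (1/2 + (3/2) tanh²x)·ξ(x) + (λ/(4 cosh²x))·ξ(x) = 0 with λ = −6. -/
open Real

/-- The function `ξ(x) = cosh²x` is an eigenfunction of the Jacobi operator of the
identity self-map of `SU(3)` with eigenvalue `λ = -6`. -/
theorem first_eigenfunction_su3_identity (lam : ℝ) (hlam : lam = -6)
    (ξ : ℝ → ℝ) (hξ : ξ = fun x : ℝ => cosh x ^ 2) :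
    ∀ x : ℝ,
      deriv (deriv ξ) x - tanh x * deriv ξ x
      - (1 / 2 + (3 / 2) * tanh x ^ 2) * ξ x
      + (lam / (4 * cosh x ^ 2)) * ξ x = 0 := by
  subst hlam hξ
  intro x
  have h1 : deriv (fun y : ℝ => cosh y ^ 2) = fun y => 2 * cosh y * sinh y := by
    funext y
    simp
  have h2 : deriv (fun y : ℝ => 2 * cosh y * sinh y) x
      = 2 * sinh x * sinh x + 2 * cosh x * cosh x :=
    (((Real.hasDerivAt_cosh x).const_mul 2).mul (Real.hasDerivAt_sinh x)).deriv
  have hc : cosh x ≠ 0 := (Real.cosh_pos x).ne'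
  rw [h1, h2, Real.tanh_eq_sinh_div_cosh]
  field_simp
  linear_combination 12 * Real.cosh_sq x
end
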